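/- arXiv:1509.08179 — 4 statements merged into one kernel-verified Lean document; each statement's English description precedes it below -/
import Mathlib

section
/- Assume (A0). Let $\rho^\flat:(0,\infty)\to(0,\infty)$ be a $C^1$ function satisfying $d\rho^\flat/d\rho=\rho^\flat/(\rho+P(\rho)/c^2)$. If $(a,\rho)$ is a solution of the Friedmann system on an interval containing $0$ with $a(0)=a_0>0$, $\rho(0)=\rho_0>0$, then $\rho^\flat(\rho(t))\,a(t)^3=\rho^\flat(\rho_0)\,a_0^3$ for all $t$ in the interval; equivalently $\rho^\flat(\rho(t))/\rho^\flat(\rho_0)=(a_0/a(t))^3$. -/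
open Real Filter Set Topology

/-- Assumption (A0): `P` is a smooth function of `ρ > 0` with `0 ≤ P`,
`0 ≤ dP/dρ < c²` for `ρ > 0`, and `P → 0` as `ρ → 0⁺`. -/
def A0 (c : ℝ) (P : ℝ → ℝ) : Prop :=
  ContDiffOn ℝ (⊤ : ℕ∞) P (Set.Ioi 0) ∧
  (∀ ρ > (0 : ℝ), 0 ≤ P ρ) ∧
  (∀ ρ > (0 : ℝ), 0 ≤ deriv P ρ ∧ deriv P ρ < c ^ 2) ∧
  Filter.Tendsto P (nhdsWithin 0 (Set.Ioi 0)) (nhds 0)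

/-- A solution of the Friedmann system on a set `I`: `a > 0`, `ρ > 0`,
`a'' = (-(4πG/3)(ρ + 3P(ρ)/c²) + c²Λ/3) a` and `ρ' = -3(ρ + P(ρ)/c²) a'/a`. -/
def IsFriedmannSolution (c G Λ : ℝ) (P : ℝ → ℝ) (a ρ : ℝ → ℝ) (I : Set ℝ) : Prop :=
  ∀ t ∈ I, 0 < a t ∧ 0 < ρ t ∧
    DifferentiableAt ℝ a t ∧
    HasDerivAt (deriv a)
      ((-(4 * Real.pi * G / 3) * (ρ t + 3 * P (ρ t) / c ^ 2) + c ^ 2 * Λ / 3) * a t) t ∧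
    HasDerivAt ρ (-3 * (ρ t + P (ρ t) / c ^ 2) * (deriv a t / a t)) t

/-- A function with vanishing derivative at every point of an order-connected set is constant
on that set. -/
theorem Set.OrdConnected.eq_of_hasDerivAt_zero {I : Set ℝ} (hI : I.OrdConnected) {f : ℝ → ℝ}
    (hf : ∀ t ∈ I, HasDerivAt f 0 t) {s t : ℝ} (hs : s ∈ I) (ht : t ∈ I) : f s = f t := by
  have h := hI.convex.norm_image_sub_le_of_norm_hasDerivWithin_le (C := 0)
    (fun x hx => (hf x hx).hasDerivWithinAt) (fun _ _ => by simp) hs ht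
  rw [zero_mul, norm_le_zero_iff, sub_eq_zero] at h
  exact h.symm

/-- The derivative of `ρ♭(ρ) a³` vanishes along a solution of the Friedmann system. -/
theorem IsFriedmannSolution.hasDerivAt_flat_mul_pow {c G Λ : ℝ} {P a ρ ρflat : ℝ → ℝ}
    {I : Set ℝ} (hsol : IsFriedmannSolution c G Λ P a ρ I) (hc : 0 < c)
    (hP : ∀ r > (0 : ℝ), 0 ≤ P r)
    (hflat : ∀ r > (0 : ℝ), HasDerivAt ρflat (ρflat r / (r + P r / c ^ 2)) r)
    {t : ℝ} (ht : t ∈ I) : HasDerivAt (fun s => ρflat (ρ s) * a s ^ 3) 0 t := by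
  obtain ⟨ha, hρ, hda, -, hdρ⟩ := hsol t ht
  have hne : ρ t + P (ρ t) / c ^ 2 ≠ 0 := by
    have := hP _ hρ
    positivity
  refine (((hflat _ hρ).comp t hdρ).mul (hda.hasDerivAt.pow 3)).congr_deriv ?_
  generalize ρ t + P (ρ t) / c ^ 2 = w at hne ⊢
  have ha' := ha.ne'
  simp only [Function.comp_apply, Pi.pow_apply]
  field_simp
  norm_num

/-- Along any solution of the Friedmann system, `ρ♭(ρ(t)) a(t)³` is conserved, where
`dρ♭/dρ = ρ♭/(ρ + P(ρ)/c²)`. -/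
theorem rhoFlat_conservation
    (c G Λ : ℝ) (hc : 0 < c) (hG : 0 < G) (hΛ : 0 < Λ)
    (P : ℝ → ℝ) (hA0 : A0 c P)
    (ρflat : ℝ → ℝ) (hflatpos : ∀ r > (0 : ℝ), 0 < ρflat r)
    (hflat : ∀ r > (0 : ℝ), HasDerivAt ρflat (ρflat r / (r + P r / c ^ 2)) r)
    (I : Set ℝ) (hIconn : I.OrdConnected) (h0I : (0 : ℝ) ∈ I)
    (a ρ : ℝ → ℝ) (hsol : IsFriedmannSolution c G Λ P a ρ I)
    (a0 ρ0 : ℝ) (ha0 : a 0 = a0) (hρ0 : ρ 0 = ρ0)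
    (ha0pos : 0 < a0) (hρ0pos : 0 < ρ0) :
    ∀ t ∈ I, ρflat (ρ t) * a t ^ 3 = ρflat ρ0 * a0 ^ 3 ∧
      ρflat (ρ t) / ρflat ρ0 = (a0 / a t) ^ 3 := by
  intro t ht
  have key : ρflat (ρ t) * a t ^ 3 = ρflat (ρ 0) * a 0 ^ 3 :=
    hIconn.eq_of_hasDerivAt_zero
      (fun s hs => hsol.hasDerivAt_flat_mul_pow hc hA0.2.1 hflat hs) ht h0I
  rw [ha0, hρ0] at key
  have hat := (hsol t ht).1
  have hpos := hflatpos _ hρ0pos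
  refine ⟨key, ?_⟩
  rw [div_pow, div_eq_div_iff hpos.ne' (by positivity), key, mul_comm]
end

section
/- (Big Bang, Theorem 1.) Assume (A0). Let $(a,\rho)$ be the solution of the Friedmann system with initial data $a(0)=a_0>0$, $a'(0)=\dot a_0$, $\rho(0)=\rho_0>0$, on its maximal interval of existence $]t_-,t_+[$ in the domain $\{a>0,\ \rho>0\}$. If $\dot a_0>0$ and $4\pi G(\rho_0+3P(\rho_0)/c^2)\ge c^2\Lambda$, then $t_-$ is finite, and $a(t)\to 0$ and $\rho(t)\to+\infty$ as $t\to t_-+0$. -/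
open Real Filter Set Topology

/-- `(a, ρ)` is a solution of the Friedmann system on the maximal interval of existence
`]t₋, t₊[` (with `-∞ ≤ t₋ < 0 < t₊ ≤ +∞`) in the domain `{a > 0, ρ > 0}`: the solution
property holds on `]t₋, t₊[`, and any solution with the same initial data at `t = 0`
is defined on a subinterval of `]t₋, t₊[`. -/
def IsMaximalSolution (c G Λ : ℝ) (P : ℝ → ℝ) (a ρ : ℝ → ℝ) (tm tp : EReal) : Prop :=
  tm < (0 : EReal) ∧ (0 : EReal) < tp ∧
  IsFriedmannSolution c G Λ P a ρ {t : ℝ | tm < (t : EReal) ∧ (t : EReal) < tp} ∧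
  ∀ (b σ : ℝ → ℝ) (s u : ℝ), s < 0 → 0 < u →
    IsFriedmannSolution c G Λ P b σ (Set.Ioo s u) →
    b 0 = a 0 → deriv b 0 = deriv a 0 → σ 0 = ρ 0 →
    tm ≤ (s : EReal) ∧ (u : EReal) ≤ tp

/-- A solution of an autonomous `C¹` ODE on `]T, u[` with a limit `x₀` at `T⁺` extends to the left
of `T`, with values in a prescribed neighbourhood of `x₀` there. -/
lemma exists_extend_left_of_tendsto {E : Type*} [NormedAddCommGroup E] [NormedSpace ℝ E]
    [CompleteSpace E] {F : E → E} {X : ℝ → E} {T u : ℝ} {x₀ : E} {U : Set E}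
    (hF : ContDiffAt ℝ 1 F x₀) (hU : U ∈ 𝓝 x₀) (hTu : T < u)
    (hX : ∀ t ∈ Ioo T u, HasDerivAt X (F (X t)) t)
    (hlim : Tendsto X (𝓝[>] T) (𝓝 x₀)) :
    ∃ (Z : ℝ → E) (s : ℝ), s < T ∧ (∀ t ∈ Ioo s u, HasDerivAt Z (F (Z t)) t) ∧
      (∀ t > T, Z t = X t) ∧ ∀ t ∈ Ioc s T, Z t ∈ U := by
  obtain ⟨Y, hYT, ε, hε, hY⟩ :=
    hF.exists_forall_mem_closedBall_exists_eq_forall_mem_Ioo_hasDerivAt₀ T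
  have hYd : HasDerivAt Y (F x₀) T := hYT ▸ hY T ⟨by linarith, by linarith⟩
  have hYU : ∀ᶠ t in 𝓝 T, Y t ∈ U := hYd.continuousAt.eventually_mem (by rwa [hYT])
  obtain ⟨δ, hδ, hδU⟩ := Metric.eventually_nhds_iff.1 hYU
  have hmin : 0 < min ε δ := lt_min hε hδ
  have hle := min_le_left ε δ
  have hle' := min_le_right ε δ
  classical
  set Z : ℝ → E := fun t => if t ≤ T then Y t else X t with hZ
  have hZl : ∀ t ≤ T, Z t = Y t := fun t ht => if_pos ht
  have hZr : ∀ t > T, Z t = X t := fun t ht => if_neg (not_le.2 ht)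
  have hZT : Z T = x₀ := (hZl T le_rfl).trans hYT
  have hZlim : Tendsto Z (𝓝[>] T) (𝓝 x₀) :=
    hlim.congr' (eventually_nhdsWithin_of_forall fun t ht => (hZr t ht).symm)
  have hder : ∀ t ∈ Ioo T u, HasDerivAt Z (F (Z t)) t := fun t ht => by
    rw [hZr t ht.1]
    exact (hX t ht).congr_of_eventuallyEq
      (eventually_of_mem (Ioi_mem_nhds ht.1) fun x hx => hZr x hx)
  refine ⟨Z, T - min ε δ, by linarith, fun t ht => ?_, hZr, fun t ht => ?_⟩
  · rcases lt_trichotomy t T with h | rfl | h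
    · rw [hZl t h.le]
      exact (hY t ⟨by linarith [ht.1], by linarith⟩).congr_of_eventuallyEq
        (eventually_of_mem (Iio_mem_nhds h) fun x hx => hZl x (le_of_lt hx))
    · have hr : HasDerivWithinAt Z (F x₀) (Ici t) t := by
        refine hasDerivWithinAt_Ici_of_tendsto_deriv (s := Ioo t u)
          (fun x hx => (hder x hx).differentiableAt.differentiableWithinAt) ?_
          (Ioo_mem_nhdsGT hTu) ?_
        · rw [ContinuousWithinAt, hZT]
          exact hZlim.mono_left (nhdsWithin_mono _ Ioo_subset_Ioi_self)
        · refine (hF.continuousAt.tendsto.comp hZlim).congr' ?_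
          filter_upwards [Ioo_mem_nhdsGT hTu] with x hx
          exact (hder x hx).deriv.symm
      have hl : HasDerivWithinAt Z (F x₀) (Iic t) t :=
        hYd.hasDerivWithinAt.congr (fun x hx => hZl x hx) (hZl t le_rfl)
      rw [hZT]
      simpa using hl.union hr
    · exact hder t ⟨h, ht.2⟩
  · rw [hZl t ht.2]
    refine hδU ?_
    rw [Real.dist_eq, abs_lt]
    constructor <;> linarith [ht.1, ht.2]

namespace A0

variable {c : ℝ} {P : ℝ → ℝ}

lemma differentiableAt (h : A0 c P) {r : ℝ} (hr : 0 < r) : DifferentiableAt ℝ P r :=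
  (h.1.contDiffAt (Ioi_mem_nhds hr)).differentiableAt (by simp)

lemma monotoneOn (h : A0 c P) : MonotoneOn P (Ioi 0) :=
  monotoneOn_of_deriv_nonneg (convex_Ioi 0) h.1.continuousOn
    (fun _ hx => (h.differentiableAt (interior_subset hx)).differentiableWithinAt)
    fun x hx => (h.2.2.1 x (interior_subset hx)).1

lemma le_mul (h : A0 c P) {r : ℝ} (hr : 0 < r) : P r ≤ c ^ 2 * r := by
  have hmono : MonotoneOn (fun x => c ^ 2 * x - P x) (Ioi 0) := by
    have hd : ∀ x ∈ Ioi (0 : ℝ), HasDerivAt (fun x => c ^ 2 * x - P x) (c ^ 2 - deriv P x) x :=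
      fun x hx => by
        exact (hasDerivAt_const_mul (c ^ 2)).fun_sub (h.differentiableAt hx).hasDerivAt
    refine monotoneOn_of_hasDerivWithinAt_nonneg (convex_Ioi 0)
      (fun x hx => (hd x hx).continuousAt.continuousWithinAt)
      (fun x hx => (hd x (interior_subset hx)).hasDerivWithinAt) fun x hx => ?_
    linarith [(h.2.2.1 x (interior_subset hx)).2]
  have hlim : Tendsto (fun x => c ^ 2 * x - P x) (𝓝[>] 0) (𝓝 0) := by
    have : Tendsto (fun x : ℝ => c ^ 2 * x) (𝓝[>] 0) (𝓝 (c ^ 2 * 0)) :=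
      ((continuous_const.mul continuous_id).tendsto 0).mono_left nhdsWithin_le_nhds
    simpa using this.sub h.2.2.2
  have hle : 0 ≤ c ^ 2 * r - P r := by
    refine le_of_tendsto hlim ?_
    filter_upwards [Ioo_mem_nhdsGT hr] with x hx
    exact hmono hx.1 hr hx.2.le
  linarith

end A0

/-- The Friedmann system as a first-order vector field in the variables `(a, a', ρ)`. -/
noncomputable def friedmannField (c G Λ : ℝ) (P : ℝ → ℝ) (x : ℝ × ℝ × ℝ) : ℝ × ℝ × ℝ :=
  (x.2.1,
    (-(4 * Real.pi * G / 3) * (x.2.2 + 3 * P x.2.2 / c ^ 2) + c ^ 2 * Λ / 3) * x.1,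
    -3 * (x.2.2 + P x.2.2 / c ^ 2) * (x.2.1 / x.1))

lemma contDiffAt_friedmannField {c G Λ : ℝ} {P : ℝ → ℝ} (hP : A0 c P) {x : ℝ × ℝ × ℝ}
    (hx : 0 < x.1) (hx' : 0 < x.2.2) : ContDiffAt ℝ 1 (friedmannField c G Λ P) x := by
  have h1 : ContDiffAt ℝ 1 (fun y : ℝ × ℝ × ℝ => y.1) x := contDiffAt_fst
  have h2 : ContDiffAt ℝ 1 (fun y : ℝ × ℝ × ℝ => y.2.1) x := contDiffAt_snd.fst
  have h3 : ContDiffAt ℝ 1 (fun y : ℝ × ℝ × ℝ => y.2.2) x := contDiffAt_snd.snd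
  have hPx : ContDiffAt ℝ 1 P x.2.2 :=
    (hP.1.contDiffAt (Ioi_mem_nhds hx')).of_le (by exact_mod_cast le_top)
  have h4 : ContDiffAt ℝ 1 (fun y : ℝ × ℝ × ℝ => P y.2.2) x := hPx.comp x h3
  refine h2.prodMk (ContDiffAt.prodMk ?_ ?_)
  · exact ((contDiffAt_const.mul (h3.add ((contDiffAt_const.mul h4).div_const _))).add
      contDiffAt_const).mul h1
  · exact (contDiffAt_const.mul (h3.add (h4.div_const _))).mul (h2.div h1 hx.ne')

namespace IsFriedmannSolution

variable {c G Λ : ℝ} {P a ρ : ℝ → ℝ} {I : Set ℝ}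

lemma mono {J : Set ℝ} (h : IsFriedmannSolution c G Λ P a ρ I) (hJ : J ⊆ I) :
    IsFriedmannSolution c G Λ P a ρ J := fun t ht => h t (hJ ht)

lemma hasDerivAt (h : IsFriedmannSolution c G Λ P a ρ I) {t : ℝ} (ht : t ∈ I) :
    HasDerivAt (fun t => (a t, deriv a t, ρ t))
      (friedmannField c G Λ P (a t, deriv a t, ρ t)) t :=
  have h' := h t ht
  h'.2.2.1.hasDerivAt.prodMk (h'.2.2.2.1.prodMk h'.2.2.2.2)

/-- An integral curve of `friedmannField` in `{a > 0, ρ > 0}` yields a Friedmann solution. -/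
lemma of_hasDerivAt {Z : ℝ → ℝ × ℝ × ℝ} (hI : IsOpen I)
    (hZ : ∀ t ∈ I, HasDerivAt Z (friedmannField c G Λ P (Z t)) t)
    (hpos : ∀ t ∈ I, 0 < (Z t).1 ∧ 0 < (Z t).2.2) :
    IsFriedmannSolution c G Λ P (fun t => (Z t).1) (fun t => (Z t).2.2) I := by
  have hd : ∀ t ∈ I, HasDerivAt (fun t => (Z t).1) (Z t).2.1 t := fun t ht => (hZ t ht).fst
  intro t ht
  refine ⟨(hpos t ht).1, (hpos t ht).2, (hd t ht).differentiableAt, ?_, ?_⟩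
  · have hv : HasDerivAt (fun t => (Z t).2.1) (friedmannField c G Λ P (Z t)).2.1 t :=
      (hZ t ht).snd.fst
    exact hv.congr_of_eventuallyEq
      (eventually_of_mem (hI.mem_nhds ht) fun x hx => (hd x hx).deriv)
  · rw [(hd t ht).deriv]
    exact (hZ t ht).snd.snd

lemma monotoneOn_scale (h : IsFriedmannSolution c G Λ P a ρ I) (hI : Convex ℝ I)
    (ha : ∀ t ∈ interior I, 0 ≤ deriv a t) : MonotoneOn a I :=
  monotoneOn_of_deriv_nonneg hI (fun t ht => (h t ht).2.2.1.continuousAt.continuousWithinAt)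
    (fun t ht => (h t (interior_subset ht)).2.2.1.differentiableWithinAt) ha

lemma hasDerivAt_density_mul_pow (h : IsFriedmannSolution c G Λ P a ρ I) (n : ℕ) {t : ℝ}
    (ht : t ∈ I) : HasDerivAt (fun t => ρ t * a t ^ n)
      (((n - 3) * ρ t - 3 * (P (ρ t) / c ^ 2)) * (deriv a t * a t ^ n / a t)) t := by
  obtain ⟨hat, -, had, -, hρ⟩ := h t ht
  refine (hρ.fun_mul (had.hasDerivAt.fun_pow n)).congr_deriv ?_
  rcases n with _ | n
  · simp; ring
  · field_simp
    push_cast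
    ring

lemma antitoneOn_density_mul_pow (hP : A0 c P) (h : IsFriedmannSolution c G Λ P a ρ I)
    (hI : Convex ℝ I) (ha : ∀ t ∈ interior I, 0 ≤ deriv a t) {n : ℕ} (hn : n ≤ 3) :
    AntitoneOn (fun t => ρ t * a t ^ n) I := by
  refine antitoneOn_of_hasDerivWithinAt_nonpos hI
    (fun t ht => (h.hasDerivAt_density_mul_pow n ht).continuousAt.continuousWithinAt)
    (fun t ht => (h.hasDerivAt_density_mul_pow n (interior_subset ht)).hasDerivWithinAt)
    fun t ht => ?_
  obtain ⟨hat, hρt, -⟩ := h t (interior_subset ht)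
  have hn' : (n : ℝ) ≤ 3 := by exact_mod_cast hn
  have h1 : 0 ≤ P (ρ t) / c ^ 2 := div_nonneg (hP.2.1 _ hρt) (sq_nonneg c)
  have h2 : 0 ≤ deriv a t * a t ^ n / a t :=
    div_nonneg (mul_nonneg (ha t ht) (by positivity)) hat.le
  refine mul_nonpos_of_nonpos_of_nonneg ?_ h2
  nlinarith [mul_nonneg (sub_nonneg.2 hn') hρt.le]

lemma antitoneOn_density (hP : A0 c P) (h : IsFriedmannSolution c G Λ P a ρ I)
    (hI : Convex ℝ I) (ha : ∀ t ∈ interior I, 0 ≤ deriv a t) : AntitoneOn ρ I := by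
  simpa using antitoneOn_density_mul_pow hP h hI ha (Nat.zero_le 3)

lemma monotoneOn_density_mul_pow (hc : 0 < c) (hP : A0 c P)
    (h : IsFriedmannSolution c G Λ P a ρ I)
    (hI : Convex ℝ I) (ha : ∀ t ∈ interior I, 0 ≤ deriv a t) :
    MonotoneOn (fun t => ρ t * a t ^ 6) I := by
  refine monotoneOn_of_hasDerivWithinAt_nonneg hI
    (fun t ht => (h.hasDerivAt_density_mul_pow 6 ht).continuousAt.continuousWithinAt)
    (fun t ht => (h.hasDerivAt_density_mul_pow 6 (interior_subset ht)).hasDerivWithinAt)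
    fun t ht => ?_
  obtain ⟨hat, hρt, -⟩ := h t (interior_subset ht)
  have h1 : P (ρ t) / c ^ 2 ≤ ρ t := by
    rw [div_le_iff₀ (by positivity)]
    linarith [hP.le_mul hρt]
  have h2 : 0 ≤ deriv a t * a t ^ 6 / a t :=
    div_nonneg (mul_nonneg (ha t ht) (by positivity)) hat.le
  refine mul_nonneg ?_ h2
  push_cast
  linarith

/-- Deceleration: `a''` is nonpositive wherever `ρ ≥ ρ₀` and `ρ₀` satisfies
`4πG(ρ₀ + 3P(ρ₀)/c²) ≥ c²Λ`; hence `a'` is antitone. -/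
lemma antitoneOn_deriv (hG : 0 < G) (hP : A0 c P) (h : IsFriedmannSolution c G Λ P a ρ I)
    (hI : Convex ℝ I) {ρ₀ : ℝ} (hρ₀ : 0 < ρ₀)
    (hcond : c ^ 2 * Λ ≤ 4 * Real.pi * G * (ρ₀ + 3 * P ρ₀ / c ^ 2))
    (hρ : ∀ t ∈ I, ρ₀ ≤ ρ t) : AntitoneOn (deriv a) I := by
  refine antitoneOn_of_hasDerivWithinAt_nonpos hI
    (fun t ht => (h t ht).2.2.2.1.continuousAt.continuousWithinAt)
    (fun t ht => (h t (interior_subset ht)).2.2.2.1.hasDerivWithinAt) fun t ht => ?_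
  have ht := interior_subset ht
  obtain ⟨hat, hρt, -⟩ := h t ht
  refine mul_nonpos_of_nonpos_of_nonneg ?_ hat.le
  have hPle : P ρ₀ ≤ P (ρ t) := hP.monotoneOn hρ₀ hρt (hρ t ht)
  have hle : ρ₀ + 3 * P ρ₀ / c ^ 2 ≤ ρ t + 3 * P (ρ t) / c ^ 2 := by
    have := hρ t ht
    gcongr
  have := mul_le_mul_of_nonneg_left hle (by positivity : 0 ≤ 4 * Real.pi * G)
  linarith

/-- Going backwards in time from a decelerating state, the expansion rate stays above its initial
value. -/
lemma deriv_zero_le (hG : 0 < G) (hP : A0 c P) {s : ℝ} (hs : s ≤ 0)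
    (h : IsFriedmannSolution c G Λ P a ρ (Icc s 0)) (ha : 0 < deriv a 0)
    (hcond : c ^ 2 * Λ ≤ 4 * Real.pi * G * (ρ 0 + 3 * P (ρ 0) / c ^ 2)) :
    deriv a 0 ≤ deriv a s := by
  have key : ∀ r ∈ Icc s 0, (∀ t ∈ Ioo r 0, 0 ≤ deriv a t) → deriv a 0 ≤ deriv a r := by
    intro r hr hpos
    have hr' : IsFriedmannSolution c G Λ P a ρ (Icc r 0) := h.mono (Icc_subset_Icc_left hr.1)
    have hρ := antitoneOn_density hP hr' (convex_Icc r 0) (by rwa [interior_Icc])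
    exact antitoneOn_deriv hG hP hr' (convex_Icc r 0) (h 0 ⟨hs, le_rfl⟩).2.1 hcond
      (fun t ht => hρ ht ⟨hr.2, le_rfl⟩ ht.2) ⟨le_rfl, hr.2⟩ ⟨hr.2, le_rfl⟩ hr.2
  refine key s ⟨le_rfl, hs⟩ fun t ht => ?_
  by_contra! hneg
  have hcont : ContinuousOn (deriv a) (Icc s 0) :=
    fun t ht => (h t ht).2.2.2.1.continuousAt.continuousWithinAt
  have hcpt : IsCompact (Icc s 0 ∩ deriv a ⁻¹' Iic 0) :=
    isCompact_Icc.of_isClosed_subset (hcont.preimage_isClosed_of_isClosed isClosed_Icc isClosed_Iic)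
      inter_subset_left
  obtain ⟨r, ⟨hr, hr0⟩, hmax⟩ := hcpt.exists_isGreatest ⟨t, Ioo_subset_Icc_self ht, hneg.le⟩
  have := key r hr fun x hx => by
    by_contra! hx0
    exact absurd (hmax ⟨⟨hr.1.trans hx.1.le, hx.2.le⟩, hx0.le⟩) (not_le.2 hx.1)
  exact absurd hr0 (not_le.2 (ha.trans_le this))

/-- If the scale factor stays bounded away from zero near the left endpoint `T`, an expanding
decelerating solution has a limit at `T⁺` in the domain `{a > 0, ρ > 0}`. -/
lemma exists_tendsto (hc : 0 < c) (hG : 0 < G) (hΛ : 0 < Λ) (hP : A0 c P) {T L : ℝ}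
    (hT : T < 0) (h : IsFriedmannSolution c G Λ P a ρ (Ioc T 0))
    (ha : ∀ t ∈ Ioc T 0, deriv a 0 ≤ deriv a t) (ha0 : 0 < deriv a 0)
    (hL : 0 < L) (hLa : ∀ t ∈ Ioc T 0, L ≤ a t)
    (hanti : AntitoneOn (deriv a) (Ioc T 0)) :
    ∃ x : ℝ × ℝ × ℝ, 0 < x.1 ∧ 0 < x.2.2 ∧
      Tendsto (fun t => (a t, deriv a t, ρ t)) (𝓝[>] T) (𝓝 x) := by
  have hconv : Convex ℝ (Ioc T (0 : ℝ)) := convex_Ioc T 0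
  have h0 : (0 : ℝ) ∈ Ioc T 0 := ⟨hT, le_rfl⟩
  have hpos : ∀ t ∈ interior (Ioc T (0 : ℝ)), 0 ≤ deriv a t :=
    fun t ht => ha0.le.trans (ha t (interior_subset ht))
  have hamono := h.monotoneOn_scale hconv hpos
  have hρanti := antitoneOn_density hP h hconv hpos
  have hρ6 := monotoneOn_density_mul_pow hc hP h hconv hpos
  set M := ρ 0 * a 0 ^ 6 / L ^ 6 with hM
  have hρM : ∀ t ∈ Ioc T 0, ρ t ≤ M := fun t ht => by
    rw [hM, le_div_iff₀ (by positivity)]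
    have h1 : ρ t * a t ^ 6 ≤ ρ 0 * a 0 ^ 6 := hρ6 ht h0 ht.2
    have h2 : L ^ 6 ≤ a t ^ 6 := pow_le_pow_left₀ hL.le (hLa t ht) 6
    exact (mul_le_mul_of_nonneg_left h2 (h t ht).2.1.le).trans h1
  have hM0 : 0 < M := (h 0 h0).2.1.trans_le (hρM 0 h0)
  have ha00 := (h 0 h0).1
  set K := 4 * Real.pi * G / 3 * (4 * M) * a 0 with hK
  have hvmono : MonotoneOn (fun t => deriv a t + K * t) (Ioc T 0) := by
    have hd : ∀ t ∈ Ioc T 0, HasDerivAt (fun t => deriv a t + K * t)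
        ((-(4 * Real.pi * G / 3) * (ρ t + 3 * P (ρ t) / c ^ 2) + c ^ 2 * Λ / 3) * a t + K) t :=
      fun t ht => by
        exact (h t ht).2.2.2.1.fun_add (hasDerivAt_const_mul K)
    refine monotoneOn_of_hasDerivWithinAt_nonneg hconv
      (fun t ht => (hd t ht).continuousAt.continuousWithinAt)
      (fun t ht => (hd t (interior_subset ht)).hasDerivWithinAt) fun t ht => ?_
    have ht := interior_subset ht
    obtain ⟨hat, hρt, -⟩ := h t ht
    have h1 : ρ t + 3 * P (ρ t) / c ^ 2 ≤ 4 * M := by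
      have : P (ρ t) / c ^ 2 ≤ ρ t := by
        rw [div_le_iff₀ (by positivity)]
        linarith [hP.le_mul hρt]
      have := hρM t ht
      rw [mul_div_assoc]
      linarith
    have h2 : 4 * Real.pi * G / 3 * (ρ t + 3 * P (ρ t) / c ^ 2) * a t ≤ K := by
      have := hamono ht h0 ht.2
      rw [hK]
      gcongr
    have h3 : 0 ≤ c ^ 2 * Λ / 3 * a t := by positivity
    linarith
  have hK0 : 0 < K := by positivity
  have hne : (Ioo T (0 : ℝ)).Nonempty := nonempty_Ioo.2 hT
  have hsub : Ioo T (0 : ℝ) ⊆ Ioc T 0 := Ioo_subset_Ioc_self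
  have hIoc : ∀ᶠ t in 𝓝[>] T, t ∈ Ioc T 0 := Ioc_mem_nhdsGT hT
  have la := (hamono.mono hsub).tendsto_nhdsWithin_Ioo_right hne
    ⟨L, forall_mem_image.2 fun t ht => hLa t (hsub ht)⟩
  have lρ := (hρanti.mono hsub).tendsto_nhdsWithin_Ioo_right hne
    ⟨M, forall_mem_image.2 fun t ht => hρM t (hsub ht)⟩
  have lv := (hanti.mono hsub).tendsto_nhdsWithin_Ioo_right hne
    ⟨deriv a 0 - K * T, forall_mem_image.2 fun t ht => by
      have h1 : deriv a t + K * t ≤ deriv a 0 + K * 0 := hvmono (hsub ht) h0 ht.2.le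
      have h2 : K * T ≤ K * t := mul_le_mul_of_nonneg_left ht.1.le hK0.le
      linarith⟩
  refine ⟨(_, _, _), hL.trans_le ?_, (h 0 h0).2.1.trans_le ?_, la.prodMk_nhds (lv.prodMk_nhds lρ)⟩
  · exact ge_of_tendsto la (hIoc.mono fun t ht => hLa t ht)
  · exact ge_of_tendsto lρ (hIoc.mono fun t ht => hρanti ht h0 ht.2)

end IsFriedmannSolution

/-- Theorem 1 (Big Bang): if `ȧ₀ > 0` and `4πG(ρ₀ + 3P(ρ₀)/c²) ≥ c²Λ`, then `t₋` is
finite and `a(t) → 0`, `ρ(t) → +∞` as `t → t₋ + 0`. -/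
theorem big_bang
    (c G Λ : ℝ) (hc : 0 < c) (hG : 0 < G) (hΛ : 0 < Λ)
    (P : ℝ → ℝ) (hA0 : A0 c P)
    (a ρ : ℝ → ℝ) (tm tp : EReal)
    (hmax : IsMaximalSolution c G Λ P a ρ tm tp)
    (a0 adot0 ρ0 : ℝ) (ha0 : a 0 = a0) (hadot0 : deriv a 0 = adot0) (hρ0 : ρ 0 = ρ0)
    (ha0pos : 0 < a0) (hρ0pos : 0 < ρ0) (hadot0pos : 0 < adot0)
    (hcond : c ^ 2 * Λ ≤ 4 * Real.pi * G * (ρ0 + 3 * P ρ0 / c ^ 2)) :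
    ∃ T : ℝ, tm = (T : EReal) ∧
      Filter.Tendsto a (nhdsWithin T (Set.Ioi T)) (nhds 0) ∧
      Filter.Tendsto ρ (nhdsWithin T (Set.Ioi T)) Filter.atTop := by
  subst ha0 hadot0 hρ0
  obtain ⟨htm, htp, hsol, hext⟩ := hmax
  have hderiv : ∀ t : ℝ, tm < t → t ≤ 0 → deriv a 0 ≤ deriv a t := fun t ht ht0 =>
    IsFriedmannSolution.deriv_zero_le hG hA0 ht0
      (hsol.mono fun x hx => ⟨ht.trans_le (by exact_mod_cast hx.1),
        lt_of_le_of_lt (by exact_mod_cast hx.2) htp⟩) hadot0pos hcond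
  have hlow : ∀ t : ℝ, tm < t → t ≤ 0 → -(a 0 / deriv a 0) < t := fun t ht ht0 => by
    have hsub : IsFriedmannSolution c G Λ P a ρ (Icc t 0) :=
      hsol.mono fun x hx => ⟨ht.trans_le (by exact_mod_cast hx.1),
        lt_of_le_of_lt (by exact_mod_cast hx.2) htp⟩
    have hle := (convex_Icc t 0).mul_sub_le_image_sub_of_le_deriv
      (fun x hx => (hsub x hx).2.2.1.continuousAt.continuousWithinAt)
      (fun x hx => (hsub x (interior_subset hx)).2.2.1.differentiableWithinAt)
      (C := deriv a 0) (fun x hx => by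
        have hx := interior_subset hx
        exact hderiv x (ht.trans_le (by exact_mod_cast hx.1)) hx.2)
      t ⟨le_rfl, ht0⟩ 0 ⟨ht0, le_rfl⟩ ht0
    have hat := (hsub t ⟨le_rfl, ht0⟩).1
    rw [neg_lt, lt_div_iff₀ hadot0pos]
    linarith
  obtain ⟨T, rfl⟩ : ∃ T : ℝ, tm = T := by
    have hbot : tm ≠ ⊥ := by
      rintro rfl
      have hneg : -(a 0 / deriv a 0) ≤ 0 := neg_nonpos.2 (by positivity)
      exact lt_irrefl _ (hlow _ (EReal.bot_lt_coe _) hneg)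
    exact ⟨tm.toReal, (EReal.coe_toReal htm.ne_top hbot).symm⟩
  have hT : T < 0 := by exact_mod_cast htm
  obtain ⟨u, hu0, hutp⟩ := EReal.lt_iff_exists_real_btwn.1 htp
  have hu0 : 0 < u := by exact_mod_cast hu0
  have hsolu : IsFriedmannSolution c G Λ P a ρ (Ioo T u) :=
    hsol.mono fun x hx => ⟨by exact_mod_cast hx.1, lt_trans (by exact_mod_cast hx.2) hutp⟩
  have hsol0 : IsFriedmannSolution c G Λ P a ρ (Ioc T 0) :=
    hsolu.mono fun x hx => ⟨hx.1, hx.2.trans_lt hu0⟩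
  have hconv : Convex ℝ (Ioc T (0 : ℝ)) := convex_Ioc T 0
  have h0 : (0 : ℝ) ∈ Ioc T 0 := ⟨hT, le_rfl⟩
  have hda : ∀ t ∈ Ioc T 0, deriv a 0 ≤ deriv a t :=
    fun t ht => hderiv t (by exact_mod_cast ht.1) ht.2
  have hpos : ∀ t ∈ interior (Ioc T (0 : ℝ)), 0 ≤ deriv a t :=
    fun t ht => hadot0pos.le.trans (hda t (interior_subset ht))
  have hamono := hsol0.monotoneOn_scale hconv hpos
  have hρanti := IsFriedmannSolution.antitoneOn_density hA0 hsol0 hconv hpos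
  have hvanti := IsFriedmannSolution.antitoneOn_deriv hG hA0 hsol0 hconv hρ0pos hcond
    fun t ht => hρanti ht h0 ht.2
  have hIoc : ∀ᶠ t in 𝓝[>] T, t ∈ Ioc T 0 := Ioc_mem_nhdsGT hT
  have hsmall : ∀ ε > 0, ∃ t ∈ Ioc T 0, a t < ε := by
    by_contra! hbdd
    obtain ⟨L, hL, hLa⟩ := hbdd
    obtain ⟨x, hx1, hx2, hlim⟩ := IsFriedmannSolution.exists_tendsto hc hG hΛ hA0 hT hsol0 hda
      hadot0pos hL hLa hvanti
    have hU : {y : ℝ × ℝ × ℝ | 0 < y.1 ∧ 0 < y.2.2} ∈ 𝓝 x :=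
      ((isOpen_lt continuous_const continuous_fst).inter
        (isOpen_lt continuous_const continuous_snd.snd)).mem_nhds ⟨hx1, hx2⟩
    obtain ⟨Z, s, hsT, hZ, hZX, hZU⟩ := exists_extend_left_of_tendsto
      (contDiffAt_friedmannField hA0 hx1 hx2) hU (hT.trans hu0)
      (fun t ht => hsolu.hasDerivAt ht) hlim
    have hZsol := IsFriedmannSolution.of_hasDerivAt isOpen_Ioo hZ fun t ht => by
      rcases le_or_gt t T with h | h
      · exact hZU t ⟨ht.1, h⟩
      · rw [hZX t h]
        exact ⟨(hsolu t ⟨h, ht.2⟩).1, (hsolu t ⟨h, ht.2⟩).2.1⟩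
    have hd : deriv (fun t => (Z t).1) 0 = deriv a 0 :=
      Filter.EventuallyEq.deriv_eq
        (eventually_of_mem (Ioi_mem_nhds hT) fun t ht => by simp only [hZX t ht])
    have hle := (hext _ _ s u (hsT.trans hT) hu0 hZsol (by simp only [hZX 0 hT]) hd
      (by simp only [hZX 0 hT])).1
    exact absurd (by exact_mod_cast hle : T ≤ s) (not_le.2 hsT)
  have hlim : Tendsto a (𝓝[>] T) (𝓝 0) := by
    refine tendsto_order.2 ⟨fun b hb => hIoc.mono fun t ht => hb.trans (hsol0 t ht).1,
      fun b hb => ?_⟩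
    obtain ⟨t, ht, htb⟩ := hsmall b hb
    filter_upwards [Ioo_mem_nhdsGT ht.1] with x hx
    exact (hamono ⟨hx.1, hx.2.le.trans ht.2⟩ ht hx.2.le).trans_lt htb
  refine ⟨T, rfl, hlim, ?_⟩
  have hρ3 := IsFriedmannSolution.antitoneOn_density_mul_pow hA0 hsol0 hconv hpos le_rfl
  have hlim3 : Tendsto (fun t => a t ^ 3) (𝓝[>] T) (𝓝[>] 0) := by
    refine tendsto_nhdsWithin_iff.2 ⟨by simpa using hlim.pow 3, ?_⟩
    exact hIoc.mono fun t ht => pow_pos (hsol0 t ht).1 3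
  refine tendsto_atTop_mono' _ ?_
    (hlim3.inv_tendsto_nhdsGT_zero.const_mul_atTop (by positivity : 0 < ρ 0 * a 0 ^ 3))
  filter_upwards [hIoc] with t ht
  have hat := (hsol0 t ht).1
  rw [Pi.inv_apply, ← div_eq_mul_inv, div_le_iff₀ (by positivity)]
  exact hρ3 ht h0 ht.2
end

section
/- Assume (A0). Let $(a,\rho)$ be the solution of the Friedmann system with initial data $a(0)=a_0>0$, $a'(0)=\dot a_0>0$, $\rho(0)=\rho_0>0$, on its maximal interval of existence $]t_-,t_+[$ in $\{a>0,\ \rho>0\}$, and suppose $4\pi G(\rho_0+3P(\rho_0)/c^2)\ge c^2\Lambda$. Then $a'(t)\ge \dot a_0$ for all $t\in\,]t_-,0]$; in particular $a'(t)>0$ on $]t_-,0]$. -/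
open Real Filter Set Topology

theorem A0.monotoneOn_s6 {c : ℝ} {P : ℝ → ℝ} (h : A0 c P) : MonotoneOn P (Set.Ioi 0) := by
  obtain ⟨hsmooth, -, hderiv, -⟩ := h
  refine monotoneOn_of_deriv_nonneg (convex_Ioi 0) hsmooth.continuousOn ?_ ?_
  · rw [interior_Ioi]
    exact hsmooth.differentiableOn (by simp)
  · rw [interior_Ioi]
    exact fun x hx => (hderiv x hx).1

/-- If `a' > 0` on `]s, 0[` and the acceleration condition holds at time `0`, then `ρ` and `a'`
decrease on `[s, 0]`, hence `a'(0) ≤ a'(s)`. -/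
theorem IsFriedmannSolution.deriv_zero_le_s6 {c G Λ s : ℝ} {P a ρ : ℝ → ℝ} (hc : 0 < c)
    (hG : 0 < G) (hA0 : A0 c P) (hs : s ≤ 0)
    (hsol : IsFriedmannSolution c G Λ P a ρ (Set.Icc s 0))
    (hpos : ∀ x ∈ Set.Ioo s 0, 0 < deriv a x)
    (hcond : c ^ 2 * Λ ≤ 4 * Real.pi * G * (ρ 0 + 3 * P (ρ 0) / c ^ 2)) :
    deriv a 0 ≤ deriv a s := by
  have h0 : (0 : ℝ) ∈ Set.Icc s 0 := ⟨hs, le_rfl⟩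
  have hsm : s ∈ Set.Icc s 0 := ⟨le_rfl, hs⟩
  have hρ : AntitoneOn ρ (Set.Icc s 0) := by
    refine antitoneOn_of_hasDerivWithinAt_nonpos (convex_Icc s 0)
      (fun x hx => (hsol x hx).2.2.2.2.continuousAt.continuousWithinAt)
      (fun x hx => (hsol x (interior_subset hx)).2.2.2.2.hasDerivWithinAt) ?_
    intro x hx
    obtain ⟨ha, hr, -⟩ := hsol x (interior_subset hx)
    rw [interior_Icc] at hx
    have h1 : 0 ≤ ρ x + P (ρ x) / c ^ 2 := by
      have := hA0.2.1 _ hr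
      positivity
    have h2 : 0 ≤ deriv a x / a x := (div_pos (hpos x hx) ha).le
    have := mul_nonneg h1 h2
    linarith
  have ha : AntitoneOn (deriv a) (Set.Icc s 0) := by
    refine antitoneOn_of_hasDerivWithinAt_nonpos (convex_Icc s 0)
      (fun x hx => (hsol x hx).2.2.2.1.continuousAt.continuousWithinAt)
      (fun x hx => (hsol x (interior_subset hx)).2.2.2.1.hasDerivWithinAt) ?_
    intro x hx
    have hx' := interior_subset hx
    obtain ⟨ha, hr, -⟩ := hsol x hx'
    have h1 : ρ 0 ≤ ρ x := hρ hx' h0 hx'.2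
    have h2 : P (ρ 0) ≤ P (ρ x) := hA0.monotoneOn_s6 (hsol 0 h0).2.1 hr h1
    have h3 : ρ 0 + 3 * P (ρ 0) / c ^ 2 ≤ ρ x + 3 * P (ρ x) / c ^ 2 := by gcongr
    have h4 : 4 * Real.pi * G * (ρ 0 + 3 * P (ρ 0) / c ^ 2) ≤
        4 * Real.pi * G * (ρ x + 3 * P (ρ x) / c ^ 2) := by gcongr
    refine mul_nonpos_of_nonpos_of_nonneg ?_ ha.le
    linarith
  exact ha hsm h0 hs

/-- If `ȧ₀ > 0` and `4πG(ρ₀ + 3P(ρ₀)/c²) ≥ c²Λ`, then `a'(t) ≥ ȧ₀ > 0` for all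
`t ∈ ]t₋, 0]`. -/
theorem deriv_scale_factor_bounded_below_in_past
    (c G Λ : ℝ) (hc : 0 < c) (hG : 0 < G) (hΛ : 0 < Λ)
    (P : ℝ → ℝ) (hA0 : A0 c P)
    (a ρ : ℝ → ℝ) (tm tp : EReal)
    (hmax : IsMaximalSolution c G Λ P a ρ tm tp)
    (a0 adot0 ρ0 : ℝ) (ha0 : a 0 = a0) (hadot0 : deriv a 0 = adot0) (hρ0 : ρ 0 = ρ0)
    (ha0pos : 0 < a0) (hρ0pos : 0 < ρ0) (hadot0pos : 0 < adot0)
    (hcond : c ^ 2 * Λ ≤ 4 * Real.pi * G * (ρ0 + 3 * P ρ0 / c ^ 2)) :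
    ∀ t : ℝ, tm < (t : EReal) → t ≤ 0 → adot0 ≤ deriv a t ∧ 0 < deriv a t := by
  intro t ht ht0
  subst ha0 hadot0 hρ0
  obtain ⟨-, htp, hsol, -⟩ := hmax
  have hsub : ∀ s, t ≤ s → IsFriedmannSolution c G Λ P a ρ (Set.Icc s 0) := by
    intro s hs x hx
    refine hsol x ⟨ht.trans_le ?_, lt_of_le_of_lt ?_ htp⟩
    · exact EReal.coe_le_coe_iff.2 (hs.trans hx.1)
    · exact_mod_cast hx.2
  have hcont : ContinuousOn (deriv a) (Set.Icc t 0) := fun x hx =>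
    (hsub t le_rfl x hx).2.2.2.1.continuousAt.continuousWithinAt
  have hpos : ∀ x ∈ Set.Icc t 0, 0 < deriv a x := by
    by_contra! ⟨x, hx, hxn⟩
    have hcomp : IsCompact (Set.Icc t 0 ∩ deriv a ⁻¹' Set.Iic 0) :=
      isCompact_Icc.of_isClosed_subset
        (hcont.preimage_isClosed_of_isClosed isClosed_Icc isClosed_Iic) Set.inter_subset_left
    obtain ⟨s, ⟨hs, hsn⟩, hmaxs⟩ := hcomp.exists_isGreatest ⟨x, hx, hxn⟩
    have hle := (hsub s hs.1).deriv_zero_le_s6 hc hG hA0 hs.2 (fun y hy => by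
      by_contra! hy0
      exact (hmaxs ⟨⟨hs.1.trans hy.1.le, hy.2.le⟩, hy0⟩).not_gt hy.1) hcond
    exact (hadot0pos.trans_le hle).not_ge hsn
  exact ⟨(hsub t le_rfl).deriv_zero_le_s6 hc hG hA0 ht0
    (fun x hx => hpos x (Set.Ioo_subset_Icc_self hx)) hcond, hpos t ⟨le_rfl, ht0⟩⟩
end

section
/- Assume (A0) and (A1) with exponents $\Gamma\in[1,2)$, $\sigma\in(0,1]$. Let $(a,\rho)$ be a solution of the Friedmann system on an interval $]t_-,t_0]$ with $t_-$ finite, such that $a(t)\to 0$ and $\rho(t)\to+\infty$ as $t\to t_-+0$. Then the limit $\rho_1:=\lim_{t\to t_-+0} a(t)^{3\Gamma}\rho(t)$ exists and is a positive real number. -/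
open Real Filter Set Topology Asymptotics

/-- Assumption (A1): there are `1 ≤ Γ < 2` and `0 < σ ≤ 1` such that
`P(ρ) = (Γ-1) c² ρ (1 + O(ρ^{-σ}))` as `ρ → +∞`. -/
def A1 (c : ℝ) (P : ℝ → ℝ) (Γ σ : ℝ) : Prop :=
  1 ≤ Γ ∧ Γ < 2 ∧ 0 < σ ∧ σ ≤ 1 ∧
  ∃ E : ℝ → ℝ, (∀ᶠ ρ in Filter.atTop, P ρ = (Γ - 1) * c ^ 2 * ρ * (1 + E ρ)) ∧
    E =O[Filter.atTop] fun ρ : ℝ => ρ ^ (-σ)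

/-- The defect of `Γ / (s + P(s)/c²)` from its leading behaviour `1/s` at large density. -/
noncomputable def densityDefect (c : ℝ) (P : ℝ → ℝ) (Γ s : ℝ) : ℝ :=
  Γ / (s + P s / c ^ 2) - 1 / s

theorem continuousOn_densityDefect {c : ℝ} {P : ℝ → ℝ} (hA0 : A0 c P) (Γ : ℝ) :
    ContinuousOn (densityDefect c P Γ) (Ioi 0) := by
  have hP : ContinuousOn P (Ioi 0) := hA0.1.continuousOn
  refine ((continuousOn_const (c := Γ)).div (continuousOn_id.add (hP.div_const _)) ?_).sub
    (continuousOn_const.div continuousOn_id fun s hs => ne_of_gt hs)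
  intro s hs
  have h := hA0.2.1 s hs
  have hs' : 0 < s := hs
  have hden : 0 < s + P s / c ^ 2 := by positivity
  exact hden.ne'

theorem densityDefect_isBigO {c : ℝ} (hc : 0 < c) {P : ℝ → ℝ} (hA0 : A0 c P) {Γ σ : ℝ}
    (hA1 : A1 c P Γ σ) :
    densityDefect c P Γ =O[atTop] fun s : ℝ => s ^ (-σ - 1) := by
  obtain ⟨hΓ, -, -, -, E, hPE, hE⟩ := hA1
  obtain ⟨C, hC⟩ := hE.bound
  refine IsBigO.of_bound ((Γ - 1) * C) ?_
  filter_upwards [hPE, hC, eventually_gt_atTop 0] with s hs hCs hs0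
  have hp : 0 ≤ P s / c ^ 2 := div_nonneg (hA0.2.1 s hs0) (by positivity)
  have hden : 0 < s + P s / c ^ 2 := by positivity
  have hPc : P s / c ^ 2 = (Γ - 1) * s * (1 + E s) := by
    rw [hs]; field_simp
  have hdef : densityDefect c P Γ s = -((Γ - 1) * E s / (s + P s / c ^ 2)) := by
    rw [densityDefect, div_sub_div _ _ hden.ne' hs0.ne', ← neg_div,
      div_eq_div_iff (mul_pos hden hs0).ne' hden.ne']
    rw [hPc]; ring
  rw [hdef, norm_neg, norm_div, norm_mul, Real.norm_of_nonneg (sub_nonneg.2 hΓ),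
    Real.norm_of_nonneg hden.le, Real.norm_of_nonneg (rpow_nonneg hs0.le _),
    rpow_sub_one hs0.ne']
  rw [Real.norm_of_nonneg (rpow_nonneg hs0.le _)] at hCs
  calc (Γ - 1) * ‖E s‖ / (s + P s / c ^ 2) ≤ (Γ - 1) * ‖E s‖ / s := by
        have := sub_nonneg.2 hΓ
        gcongr
        linarith
    _ ≤ (Γ - 1) * (C * s ^ (-σ)) / s := by
        have := sub_nonneg.2 hΓ
        gcongr
    _ = (Γ - 1) * C * (s ^ (-σ) / s) := by ring

theorem integrableOn_densityDefect {c : ℝ} (hc : 0 < c) {P : ℝ → ℝ} (hA0 : A0 c P) {Γ σ : ℝ}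
    (hA1 : A1 c P Γ σ) :
    MeasureTheory.IntegrableOn (densityDefect c P Γ) (Ioi 1) := by
  have hσ : 0 < σ := hA1.2.2.1
  have hcont : ContinuousOn (densityDefect c P Γ) (Ici 1) :=
    (continuousOn_densityDefect hA0 Γ).mono fun s hs =>
      show (0 : ℝ) < s from zero_lt_one.trans_le hs
  exact ((hcont.locallyIntegrableOn measurableSet_Ici).integrableOn_of_isBigO_atTop
    (densityDefect_isBigO hc hA0 hA1)
    (integrableAtFilter_rpow_atTop_iff.2 (by linarith))).mono_set Ioi_subset_Ici_self

theorem hasDerivAt_integral_densityDefect {c : ℝ} {P : ℝ → ℝ} (hA0 : A0 c P) (Γ : ℝ) {x : ℝ}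
    (hx : 0 < x) :
    HasDerivAt (fun u => ∫ s in (1 : ℝ)..u, densityDefect c P Γ s) (densityDefect c P Γ x) x := by
  have hcont := continuousOn_densityDefect hA0 Γ
  refine intervalIntegral.integral_hasDerivAt_right ?_
    (hcont.stronglyMeasurableAtFilter isOpen_Ioi x hx) (hcont.continuousAt (Ioi_mem_nhds hx))
  exact (hcont.mono fun s hs => (lt_min one_pos hx).trans_le hs.1).intervalIntegrable

/-- First integral of the Friedmann system, in logarithmic form. -/
theorem IsFriedmannSolution.hasDerivAt_log_first_integral {c G Λ : ℝ} {P : ℝ → ℝ}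
    (hA0 : A0 c P) (Γ : ℝ) {a ρ : ℝ → ℝ} {I : Set ℝ}
    (hsol : IsFriedmannSolution c G Λ P a ρ I) {t : ℝ} (ht : t ∈ I) :
    HasDerivAt (fun t => 3 * Γ * log (a t) + log (ρ t) +
      ∫ s in (1 : ℝ)..ρ t, densityDefect c P Γ s) 0 t := by
  obtain ⟨hat, hρt, hda, -, hdρ⟩ := hsol t ht
  have hp : 0 ≤ P (ρ t) / c ^ 2 := div_nonneg (hA0.2.1 _ hρt) (by positivity)
  have hden : ρ t + P (ρ t) / c ^ 2 ≠ 0 := by positivity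
  have h := (((hda.hasDerivAt.log hat.ne').const_mul (3 * Γ)).add (hdρ.log hρt.ne')).add
    ((hasDerivAt_integral_densityDefect hA0 Γ hρt).comp t hdρ)
  refine h.congr_deriv ?_
  rw [densityDefect]
  generalize ρ t + P (ρ t) / c ^ 2 = q at hden
  field_simp
  ring

/-- Under (A0) and (A1), for a solution undergoing a Big Bang at the finite time `t₋`
(`a → 0`, `ρ → +∞` as `t → t₋ + 0`), the limit `ρ₁ = lim a(t)^{3Γ} ρ(t)` exists
and is a positive real number. -/
theorem bigbang_density_scaling_limit
    (c G Λ : ℝ) (hc : 0 < c) (hG : 0 < G) (hΛ : 0 < Λ)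
    (P : ℝ → ℝ) (hA0 : A0 c P) (Γ σ : ℝ) (hA1 : A1 c P Γ σ)
    (tm t0 : ℝ) (htm : tm < t0) (a ρ : ℝ → ℝ)
    (hsol : IsFriedmannSolution c G Λ P a ρ (Set.Ioc tm t0))
    (ha : Filter.Tendsto a (nhdsWithin tm (Set.Ioi tm)) (nhds 0))
    (hρ : Filter.Tendsto ρ (nhdsWithin tm (Set.Ioi tm)) Filter.atTop) :
    ∃ ρ1 : ℝ, 0 < ρ1 ∧
      Filter.Tendsto (fun t => a t ^ (3 * Γ) * ρ t)
        (nhdsWithin tm (Set.Ioi tm)) (nhds ρ1) := by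
  set F : ℝ → ℝ := fun u => ∫ s in (1 : ℝ)..u, densityDefect c P Γ s
  have hF : Tendsto (fun t => F (ρ t)) (𝓝[>] tm)
      (𝓝 (∫ s in Ioi 1, densityDefect c P Γ s)) :=
    MeasureTheory.intervalIntegral_tendsto_integral_Ioi 1
      (integrableOn_densityDefect hc hA0 hA1) hρ
  have hderiv : ∀ t ∈ Ioc tm t0,
      HasDerivAt (fun t => 3 * Γ * log (a t) + log (ρ t) + F (ρ t)) 0 t :=
    fun t ht => hsol.hasDerivAt_log_first_integral hA0 Γ ht
  obtain ⟨K, hK⟩ := isOpen_Ioo.exists_is_const_of_deriv_eq_zero isPreconnected_Ioo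
    (fun t ht => (hderiv t (Ioo_subset_Ioc_self ht)).differentiableAt.differentiableWithinAt)
    (fun t ht => (hderiv t (Ioo_subset_Ioc_self ht)).deriv)
  refine ⟨exp (K - ∫ s in Ioi 1, densityDefect c P Γ s), exp_pos _, ?_⟩
  refine ((continuous_exp.tendsto _).comp (hF.const_sub K)).congr' ?_
  filter_upwards [Ioo_mem_nhdsGT htm] with t ht
  obtain ⟨hat, hρt, -⟩ := hsol t (Ioo_subset_Ioc_self ht)
  have hKt : K - F (ρ t) = log (a t) * (3 * Γ) + log (ρ t) := by
    linarith [hK t ht]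
  rw [Function.comp_apply, hKt, exp_add, exp_log hρt, rpow_def_of_pos hat]
end
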